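/- For every n, d ∈ ℕ, the polynomial θ_d = Σ_{α ∈ ℕⁿ_d} x^{2α} (equal to [x]_dᵀ[x]_d, the sum of squares of all monomials of degree ≤ d) lies in the interior of the cone of sums of squares inside the space ℝ[x]_{2d} of polynomials of degree ≤ 2d: there exists δ > 0 such that every polynomial q ∈ ℝ[x₁,…,xₙ] of degree ≤ 2d whose coefficient vector satisfies ‖vec(q − θ_d)‖ < δ is a sum of squares of polynomials. -/

import Mathlib

open MvPolynomial Finset

/-- The set `ℕⁿ_d` of multi-indices `α ∈ ℕⁿ` with `|α| = α₁ + ⋯ + αₙ ≤ d`. -/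
abbrev MIdx (n d : ℕ) : Type := {α : Fin n →₀ ℕ // ∑ i, α i ≤ d}

noncomputable instance MIdx.fintype (n d : ℕ) : Fintype (MIdx n d) := by
  have hfin : {f : Fin n → ℕ | ∑ i, f i ≤ d}.Finite := by
    apply (Set.finite_Icc (0 : Fin n → ℕ) (fun _ => d)).subset
    intro f hf
    refine Set.mem_Icc.mpr ⟨fun i => Nat.zero_le _, fun i => ?_⟩
    exact le_trans (Finset.single_le_sum (fun j _ => Nat.zero_le (f j)) (Finset.mem_univ i)) hf
  have h2 : {α : Fin n →₀ ℕ | ∑ i, α i ≤ d}.Finite :=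
    Set.Finite.preimage (Set.injOn_of_injective (DFunLike.coe_injective (F := Fin n →₀ ℕ))) hfin
  exact h2.fintype

/-- The moment matrix `M_d[y]` of a truncated multi-sequence `y` of degree `2d`,
indexed by `α, β ∈ ℕⁿ_d`, with entries `y_{α+β}`. -/
noncomputable def momMat {n : ℕ} (d : ℕ) (y : MIdx n (2 * d) → ℝ) :
    Matrix (MIdx n d) (MIdx n d) ℝ := fun α β =>
  y ⟨α.1 + β.1, by
    have hα := α.2; have hβ := β.2
    have h : ∑ i, (α.1 + β.1) i = (∑ i, α.1 i) + ∑ i, β.1 i := by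
      simp [Finsupp.add_apply, Finset.sum_add_distrib]
    omega⟩

/-- The localizing matrix `L_p^{(d)}[y]` of a polynomial `p` of degree ≤ 2d at a tms `y`
of degree `2d`, indexed by `α, β ∈ ℕⁿ_t` with `t = d - ⌈deg(p)/2⌉`, with entries
`Σ_γ p_γ y_{α+β+γ}`. -/
noncomputable def locMat {n : ℕ} (d : ℕ) (p : MvPolynomial (Fin n) ℝ)
    (hp : p.totalDegree ≤ 2 * d) (y : MIdx n (2 * d) → ℝ) :
    Matrix (MIdx n (d - (p.totalDegree + 1) / 2))
      (MIdx n (d - (p.totalDegree + 1) / 2)) ℝ := fun α β =>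
  ∑ γ ∈ p.support.attach, p.coeff γ.1 *
    y ⟨α.1 + β.1 + γ.1, by
      have hα := α.2; have hβ := β.2
      have hγ : ∑ i, γ.1 i ≤ p.totalDegree := by
        have h1 := MvPolynomial.le_totalDegree γ.2
        have h2 : (γ.1.sum fun _ e => e) = ∑ i, γ.1 i :=
          Finsupp.sum_fintype _ _ (fun _ => rfl)
        omega
      have h : ∑ i, (α.1 + β.1 + γ.1) i = ((∑ i, α.1 i) + ∑ i, β.1 i) + ∑ i, γ.1 i := by
        simp [Finsupp.add_apply, Finset.sum_add_distrib]
      omega⟩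

/-- The Riesz functional `⟨f, y⟩ = Σ_{α ∈ ℕⁿ_{2d}} f_α y_α`. -/
noncomputable def riesz {n : ℕ} (d : ℕ) (f : MvPolynomial (Fin n) ℝ)
    (y : MIdx n (2 * d) → ℝ) : ℝ :=
  ∑ α : MIdx n (2 * d), f.coeff α.1 * y α

/-- The Euclidean norm of a truncated multi-sequence. -/
noncomputable def tmsNorm {n d : ℕ} (y : MIdx n d → ℝ) : ℝ :=
  Real.sqrt (∑ α, (y α) ^ 2)

/-- The vector of monomials `[x]_d = (x^α)_{α ∈ ℕⁿ_d}` evaluated at `x`. -/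
noncomputable def monVec {n : ℕ} (d : ℕ) (x : Fin n → ℝ) : MIdx n d → ℝ :=
  fun α => ∏ i, x i ^ α.1 i

/-- The coefficient vector `vec(p) ∈ ℝ^{ℕⁿ_{2d}}` of a polynomial `p ∈ ℝ[x]_{2d}`. -/
noncomputable def vecPoly {n : ℕ} (d : ℕ) (p : MvPolynomial (Fin n) ℝ) :
    MIdx n (2 * d) → ℝ := fun α => p.coeff α.1

/-- `σ` is a sum of squares of polynomials of degree at most `k`. -/
def IsSOSDeg {n : ℕ} (k : ℕ) (σ : MvPolynomial (Fin n) ℝ) : Prop :=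
  ∃ (r : ℕ) (s : Fin r → MvPolynomial (Fin n) ℝ),
    (∀ j, (s j).totalDegree ≤ k) ∧ σ = ∑ j, (s j) ^ 2

/-- Membership in the truncated quadratic module `Q(g)_{2d}`. -/
def memQ {n m : ℕ} (d : ℕ) (g : Fin m → MvPolynomial (Fin n) ℝ)
    (q : MvPolynomial (Fin n) ℝ) : Prop :=
  ∃ (σ₀ : MvPolynomial (Fin n) ℝ) (σ : Fin m → MvPolynomial (Fin n) ℝ),
    IsSOSDeg d σ₀ ∧ (∀ i, IsSOSDeg (d - ((g i).totalDegree + 1) / 2) (σ i)) ∧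
    q = σ₀ + ∑ i, g i * σ i

/-- A multi-index of degree at most `a + b` splits into multi-indices of degrees at most
`a` and `b`. -/
theorem exists_add_eq_of_sum_le {ι : Type*} [Fintype ι] {a b : ℕ} (γ : ι →₀ ℕ)
    (h : ∑ i, γ i ≤ a + b) :
    ∃ α β : ι →₀ ℕ, ∑ i, α i ≤ a ∧ ∑ i, β i ≤ b ∧ α + β = γ := by
  classical
  induction a generalizing γ with
  | zero => exact ⟨0, γ, by simp, by simpa using h, by simp⟩
  | succ a ih =>
    by_cases hγ : γ = 0
    · exact ⟨0, 0, by simp, by simp, by simp [hγ]⟩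
    · obtain ⟨i, hi⟩ := Finsupp.ne_iff.mp hγ
      have hle : Finsupp.single i 1 ≤ γ :=
        Finsupp.single_le_iff.mpr (Nat.one_le_iff_ne_zero.mpr hi)
      obtain ⟨γ', rfl⟩ := exists_add_of_le hle
      have hs : ∑ j, (Finsupp.single i 1 : ι →₀ ℕ) j = 1 := by
        simp [Finsupp.single_apply]
      simp only [Finsupp.add_apply, Finset.sum_add_distrib, hs] at h
      obtain ⟨α, β, hα, hβ, rfl⟩ := ih γ' (by omega)
      refine ⟨Finsupp.single i 1 + α, β, ?_, hβ, add_assoc _ _ _⟩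
      simp only [Finsupp.add_apply, Finset.sum_add_distrib, hs]
      omega

/-- A finite family of real polynomials with nonnegative weights gives a sum of squares. -/
theorem exists_sum_sq_of_nonneg_weights {σ ι : Type*} [Fintype ι] (w : ι → ℝ)
    (hw : ∀ i, 0 ≤ w i) (p : ι → MvPolynomial σ ℝ) :
    ∃ (r : ℕ) (s : Fin r → MvPolynomial σ ℝ), ∑ i, C (w i) * p i ^ 2 = ∑ j, (s j) ^ 2 := by
  refine ⟨Fintype.card ι,
    fun j => C (√(w ((Fintype.equivFin ι).symm j))) * p ((Fintype.equivFin ι).symm j), ?_⟩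
  rw [Equiv.sum_comp (Fintype.equivFin ι).symm (fun i => (C (√(w i)) * p i) ^ 2)]
  refine Finset.sum_congr rfl fun i _ => ?_
  rw [mul_pow, ← C_pow, Real.sq_sqrt (hw i)]

/-- A polynomial of degree at most `k` is the sum of its terms indexed by `MIdx n k`. -/
theorem sum_monomial_coeff_eq {n k : ℕ} (p : MvPolynomial (Fin n) ℝ) (hp : p.totalDegree ≤ k) :
    ∑ γ : MIdx n k, monomial γ.1 (p.coeff γ.1) = p := by
  classical
  ext m
  simp only [coeff_sum, coeff_monomial]
  by_cases hm : ∑ i, m i ≤ k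
  · rw [Finset.sum_eq_single (⟨m, hm⟩ : MIdx n k)]
    · simp
    · intro γ _ hγ
      exact if_neg fun h => hγ (Subtype.ext h)
    · simp
  · rw [Finset.sum_eq_zero]
    · refine (coeff_eq_zero_of_totalDegree_lt ?_).symm
      have : ∑ i ∈ m.support, m i = ∑ i, m i :=
        Finsupp.sum_fintype m (fun _ e => e) fun _ => rfl
      omega
    · intro γ _
      refine if_neg ?_
      rintro rfl
      exact hm γ.2

/-- Each coordinate is bounded by the Euclidean norm. -/
theorem abs_le_tmsNorm {n k : ℕ} (y : MIdx n k → ℝ) (γ : MIdx n k) : |y γ| ≤ tmsNorm y :=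
  Real.abs_le_sqrt (Finset.single_le_sum (f := fun γ => y γ ^ 2)
    (fun _ _ => sq_nonneg _) (Finset.mem_univ γ))

/-- Polarization of a term `c x^(α+β)` as a weighted square minus weighted pure squares. -/
theorem monomial_add_eq_sq_sub {σ : Type*} (α β : σ →₀ ℕ) (c : ℝ) :
    monomial (α + β) c =
      C (|c| / 2) * (monomial α 1 + C (SignType.sign c : ℝ) * monomial β 1) ^ 2
        - C (|c| / 2) * (monomial α 1 ^ 2 + monomial β (1 : ℝ) ^ 2) := by
  have hm : monomial (α + β) c = C c * (monomial α 1 * monomial β 1) := by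
    simp [monomial_mul, C_mul_monomial]
  have h1 : (C (|c| / 2) * C (SignType.sign c : ℝ) * 2 : MvPolynomial σ ℝ) = C c := by
    rw [← C_mul, show (2 : MvPolynomial σ ℝ) = C 2 from rfl, ← C_mul]
    congr 1
    linear_combination abs_mul_sign c
  have h2 : (C (|c| / 2) * C (SignType.sign c : ℝ) ^ 2 : MvPolynomial σ ℝ) = C (|c| / 2) := by
    rw [← C_pow, ← C_mul]
    congr 1
    rcases lt_trichotomy c 0 with h | rfl | h
    · simp [sign_neg h]
    · simp
    · simp [sign_pos h]
  rw [hm]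
  linear_combination (-(monomial α 1 * monomial β 1)) * h1 - monomial β 1 ^ 2 * h2

/-- The polynomial `θ_d = Σ_{α ∈ ℕⁿ_d} x^{2α} = [x]_dᵀ[x]_d` lies in the
interior of the SOS cone inside `ℝ[x]_{2d}`: there is `δ > 0` such that every polynomial
`q` of degree ≤ 2d with `‖vec(q − θ_d)‖ < δ` is a sum of squares of polynomials. -/
theorem stmt16 (n d : ℕ) (θ : MvPolynomial (Fin n) ℝ)
    (hθ : θ = ∑ α : MIdx n d, MvPolynomial.monomial (α.1 + α.1) (1 : ℝ)) :
    ∃ δ > (0 : ℝ), ∀ q : MvPolynomial (Fin n) ℝ, q.totalDegree ≤ 2 * d →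
      tmsNorm (vecPoly d (q - θ)) < δ →
      ∃ (r : ℕ) (s : Fin r → MvPolynomial (Fin n) ℝ), q = ∑ j, (s j) ^ 2 := by
  classical
  have hsplit (γ : MIdx n (2 * d)) : ∃ α β : MIdx n d, α.1 + β.1 = γ.1 := by
    obtain ⟨α, β, hα, hβ, h⟩ := exists_add_eq_of_sum_le γ.1 (γ.2.trans (two_mul d).le)
    exact ⟨⟨α, hα⟩, ⟨β, hβ⟩, h⟩
  choose a b hab using hsplit
  set N : ℝ := (Fintype.card (MIdx n (2 * d)) : ℝ) with hN
  have hN0 : 0 ≤ N := Nat.cast_nonneg _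
  refine ⟨1 / (N + 1), by positivity, fun q hq hnorm => ?_⟩
  set c : MIdx n (2 * d) → ℝ := vecPoly d (q - θ)
  have hθdeg : θ.totalDegree ≤ 2 * d := by
    rw [hθ]
    refine totalDegree_finsetSum_le fun α _ => (totalDegree_monomial_le _ _).trans ?_
    rw [Finsupp.sum_fintype _ _ fun _ => rfl]
    have := α.2
    simp only [Finsupp.add_apply, id_eq, Finset.sum_add_distrib]
    omega
  have hdiff : ∑ γ, monomial γ.1 (c γ) = q - θ :=
    sum_monomial_coeff_eq _ ((totalDegree_sub _ _).trans (max_le hq hθdeg))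
  have hcsum : ∑ γ, |c γ| ≤ 1 := by
    have h : ∑ γ, |c γ| ≤ N * (1 / (N + 1)) := by
      calc ∑ γ, |c γ| ≤ ∑ _γ : MIdx n (2 * d), 1 / (N + 1) :=
            Finset.sum_le_sum fun γ _ => (abs_le_tmsNorm c γ).trans hnorm.le
        _ = N * (1 / (N + 1)) := by simp [hN]
    refine h.trans ?_
    rw [mul_one_div, div_le_one (by positivity)]
    linarith
  let w : MIdx n d → ℝ := fun α =>
    ∑ γ, |c γ| / 2 * ((if a γ = α then 1 else 0) + if b γ = α then 1 else 0)
  have hw (α : MIdx n d) : w α ≤ 1 := by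
    refine le_trans (Finset.sum_le_sum fun γ _ => ?_) hcsum
    have := abs_nonneg (c γ)
    split_ifs <;> linarith
  have hwsum : ∑ α, C (w α) * monomial α.1 (1 : ℝ) ^ 2 =
      ∑ γ, C (|c γ| / 2) * (monomial (a γ).1 1 ^ 2 + monomial (b γ).1 (1 : ℝ) ^ 2) := by
    simp only [w, map_sum, Finset.sum_mul]
    rw [Finset.sum_comm]
    refine Finset.sum_congr rfl fun γ _ => ?_
    simp only [C_mul, C_add, mul_assoc, ← Finset.mul_sum, add_mul, Finset.sum_add_distrib,
      apply_ite C, C_1, C_0, ite_mul, one_mul, zero_mul, Finset.sum_ite_eq, Finset.mem_univ,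
      if_true]
  obtain ⟨r, s, hs⟩ := exists_sum_sq_of_nonneg_weights
    (Sum.elim (fun γ => |c γ| / 2) fun α => 1 - w α)
    (by
      rintro (γ | α)
      · exact div_nonneg (abs_nonneg _) zero_le_two
      · exact sub_nonneg.mpr (hw α))
    (Sum.elim (fun γ => monomial (a γ).1 1 + C (SignType.sign (c γ) : ℝ) * monomial (b γ).1 1)
      fun α => monomial α.1 1)
  refine ⟨r, s, hs ▸ ?_⟩
  have hθsq : θ = ∑ α : MIdx n d, monomial α.1 (1 : ℝ) ^ 2 := by
    simp [hθ, sq, monomial_mul]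
  have hterms : ∑ γ, monomial γ.1 (c γ) = ∑ γ, monomial ((a γ).1 + (b γ).1) (c γ) := by
    simp only [hab]
  simp only [monomial_add_eq_sq_sub, Finset.sum_sub_distrib] at hterms
  simp only [Fintype.sum_sum_type, Sum.elim_inl, Sum.elim_inr, C_sub, C_1, sub_mul, one_mul,
    Finset.sum_sub_distrib]
  rw [← hθsq, hwsum]
  linear_combination hterms - hdiff
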